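/- arXiv:2107.11422 — 3 statements merged into one kernel-verified Lean document; each statement's English description precedes it below -/
import Mathlib

section
/- Let n ≥ 7 be an integer and b ∈ {1, …, n−6}. Set r = −(n−b−1) + √(2(n−b−1)(n−b−2)) and s = (1/b)(−((b+1)(n−b) − 1) + √((b+1)(n−b−1)((2b+1)(n−1) − 2b²))). Then 1 < r, r < s, and s ≤ n−b−4. -/
/-- For `n ≥ 7` and `b ∈ {1, …, n-6}`, with
`r = -(n-b-1) + √(2(n-b-1)(n-b-2))` and
`s = (1/b)(-((b+1)(n-b) - 1) + √((b+1)(n-b-1)((2b+1)(n-1) - 2b²)))`, one has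
`1 < r`, `r < s` and `s ≤ n-b-4`. -/
theorem caterpillar3_last_fixed_roots_bounds (n b : ℕ) (hn : 7 ≤ n) (hb1 : 1 ≤ b)
    (hb2 : b ≤ n - 6) :
    1 < -((n : ℝ) - b - 1) + Real.sqrt (2 * ((n : ℝ) - b - 1) * ((n : ℝ) - b - 2)) ∧
    -((n : ℝ) - b - 1) + Real.sqrt (2 * ((n : ℝ) - b - 1) * ((n : ℝ) - b - 2))
      < (1 / (b : ℝ)) *
          (-(((b : ℝ) + 1) * ((n : ℝ) - b) - 1) +
            Real.sqrt (((b : ℝ) + 1) * ((n : ℝ) - b - 1) *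
              ((2 * (b : ℝ) + 1) * ((n : ℝ) - 1) - 2 * (b : ℝ) ^ 2))) ∧
    (1 / (b : ℝ)) *
        (-(((b : ℝ) + 1) * ((n : ℝ) - b) - 1) +
          Real.sqrt (((b : ℝ) + 1) * ((n : ℝ) - b - 1) *
            ((2 * (b : ℝ) + 1) * ((n : ℝ) - 1) - 2 * (b : ℝ) ^ 2)))
      ≤ (n : ℝ) - b - 4 := by
  have hb : (1 : ℝ) ≤ b := by exact_mod_cast hb1
  have hbn : b + 6 ≤ n := by omega
  have hm5 : (5 : ℝ) ≤ (n : ℝ) - b - 1 := by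
    have : (b : ℝ) + 6 ≤ n := by exact_mod_cast hbn
    linarith
  have hb0 : (0 : ℝ) < b := by linarith
  obtain ⟨m, hm⟩ : ∃ m : ℝ, m = (n : ℝ) - b - 1 := ⟨_, rfl⟩
  have hn' : (n : ℝ) = m + b + 1 := by linarith
  rw [← hm] at hm5 ⊢
  rw [hn']
  generalize (b : ℝ) = c at *
  have hm1 : 2 * m * (m + c + 1 - c - 2) = 2 * m * (m - 1) := by ring
  have hS : (c + 1) * m * ((2 * c + 1) * (m + c + 1 - 1) - 2 * c ^ 2) =
      (c + 1) * m * ((2 * c + 1) * m + c) := by ring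
  rw [hm1, hS, one_div_mul_eq_div]
  have hR : √(2 * m * (m - 1)) < (3 * m - 1) / 2 := by
    rw [Real.sqrt_lt' (by linarith)]
    nlinarith
  have hR2 := Real.sq_sqrt (show 0 ≤ 2 * m * (m - 1) by nlinarith)
  have hR0 := Real.sqrt_nonneg (2 * m * (m - 1))
  refine ⟨?_, ?_, ?_⟩
  · have : m + 1 < √(2 * m * (m - 1)) := by
      apply Real.lt_sqrt_of_sq_lt
      nlinarith
    linarith
  · rw [lt_div_iff₀ hb0]
    generalize √(2 * m * (m - 1)) = R at *
    have : c * R + m + c < √((c + 1) * m * ((2 * c + 1) * m + c)) := by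
      apply Real.lt_sqrt_of_sq_lt
      have h := mul_lt_mul_of_pos_left hR (show 0 < 2 * c * (m + c) by positivity)
      linear_combination h + c ^ 2 * hR2
    linarith
  · rw [div_le_iff₀ hb0]
    have : √((c + 1) * m * ((2 * c + 1) * m + c)) ≤ (2 * c + 1) * m - 2 * c := by
      apply Real.sqrt_le_iff.mpr
      constructor
      · nlinarith
      · have h : 0 ≤ (2 * c + 1) * m - (9 * c + 5) := by nlinarith
        have h' : 0 ≤ c * (m * ((2 * c + 1) * m - (9 * c + 5)) + 4 * c) := by positivity
        linear_combination h'
    linarith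
end

section
/- Let n ≥ 7 be an integer and let b be a real number with ((3 − 2√2)/(2√2))(n−1) ≤ b ≤ n−6. Then 8(n+b−1)²(n−b−1)(n−b−2) − (3n² − 3bn − 9n + 2b + 6)² > 0. -/
/-- For an integer `n ≥ 7` and a real `b` with
`((3 - 2√2)/(2√2))(n-1) ≤ b ≤ n - 6`, one has
`8(n+b-1)²(n-b-1)(n-b-2) - (3n² - 3bn - 9n + 2b + 6)² > 0`. -/
theorem caterpillar3_interval_length_lt_one (n : ℕ) (hn : 7 ≤ n) (b : ℝ)
    (hb1 : ((3 - 2 * Real.sqrt 2) / (2 * Real.sqrt 2)) * ((n : ℝ) - 1) ≤ b)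
    (hb2 : b ≤ (n : ℝ) - 6) :
    0 < 8 * ((n : ℝ) + b - 1) ^ 2 * ((n : ℝ) - b - 1) * ((n : ℝ) - b - 2)
        - (3 * (n : ℝ) ^ 2 - 3 * b * (n : ℝ) - 9 * (n : ℝ) + 2 * b + 6) ^ 2 := by
  have hs : 0 < √(2 : ℝ) := by positivity
  have hs2 : √(2 : ℝ) ^ 2 = 2 := Real.sq_sqrt (by norm_num)
  have hn' : (7 : ℝ) ≤ n := by exact_mod_cast hn
  generalize √(2 : ℝ) = t at *
  obtain ⟨m, hm⟩ : ∃ m : ℝ, (n : ℝ) = m + 1 := ⟨n - 1, by ring⟩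
  rw [hm] at hn' hb1 hb2 ⊢
  obtain ⟨d, rfl⟩ : ∃ d : ℝ, b = m - d := ⟨m - b, by ring⟩
  have hm0 : 0 < m := by linarith
  have hd : 5 ≤ d := by linarith
  have hlin : 3 * m ≤ 2 * t * (2 * m - d) := by
    rw [div_mul_eq_mul_div, div_le_iff₀ (by positivity)] at hb1
    linarith
  have hsq : 9 * m ^ 2 ≤ 8 * (2 * m - d) ^ 2 := by
    have h := pow_le_pow_left₀ (by positivity) hlin 2
    rw [mul_pow, mul_pow, mul_pow, hs2] at h
    linarith
  have hpos : 0 < 2 * m - d := 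
    pos_of_mul_pos_right (lt_of_lt_of_le (by positivity) hlin) (by positivity)
  have hdm : d ≤ m := by nlinarith
  have hmul : 9 * m ^ 2 * (d * (d - 1)) ≤ 8 * (2 * m - d) ^ 2 * (d * (d - 1)) :=
    mul_le_mul_of_nonneg_right hsq (mul_nonneg (by linarith) (by linarith))
  have h1 : 0 ≤ 6 * m * d * (m - d) := mul_nonneg (by positivity) (by linarith)
  have h2 : 0 ≤ d * (m - d) := mul_nonneg (by linarith) (by linarith)
  have h3 : 0 < m ^ 2 * (9 * d - 16) := mul_pos (by positivity) (by linarith)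
  have h4 : 0 < m * d := mul_pos hm0 (by linarith)
  linarith
end

section
/- Let r ≥ 2 and p_1, …, p_r ≥ 1 be integers, and let T = T(p_1, …, p_r) be the caterpillar of order n = r + p_1 + ⋯ + p_r. Then X^{(p_1−1)+(p_2−1)+⋯+(p_r−1)} divides the characteristic polynomial of the Randić matrix of T; equivalently, 0 is an eigenvalue of the Randić matrix of T with algebraic multiplicity at least Σ_{i=1}^{r}(p_i − 1). -/
open Polynomial

open scoped Classical in
/-- The Randić matrix of a simple graph `G`: the `(u,v)` entry is `1/√(d_u d_v)` when `uv` is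
an edge and `0` otherwise, where `d_v` is the degree of the vertex `v`. -/
noncomputable def randicMatrix {V : Type*} (G : SimpleGraph V) : Matrix V V ℝ :=
  Matrix.of fun u v =>
    if G.Adj u v then
      1 / Real.sqrt (((G.neighborSet u).ncard : ℝ) * ((G.neighborSet v).ncard : ℝ))
    else 0

lemma randicMatrix_isHermitian {V : Type*} (G : SimpleGraph V) :
    (randicMatrix G).IsHermitian := by
  ext u v
  by_cases h : G.Adj u v
  · simp [randicMatrix, Matrix.conjTranspose_apply, h, h.symm, mul_comm]
  · have h' : ¬ G.Adj v u := fun hc => h hc.symm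
    simp [randicMatrix, Matrix.conjTranspose_apply, h, h']

/-- The Randić energy of a graph: the sum of the absolute values of the eigenvalues of its
Randić matrix. -/
noncomputable def randicEnergy {V : Type*} [Fintype V] [DecidableEq V] (G : SimpleGraph V) : ℝ :=
  ∑ i, |(randicMatrix_isHermitian G).eigenvalues i|

/-- The caterpillar `T(p 0, …, p (r-1))`: a path `v_0 v_1 ⋯ v_{r-1}` (the `Sum.inl` vertices)
together with, for each `i`, `p i` pendant vertices attached to `v_i` (the `Sum.inr` vertices). -/
def caterpillar (r : ℕ) (p : Fin r → ℕ) :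
    SimpleGraph ((Fin r) ⊕ (Σ i : Fin r, Fin (p i))) :=
  SimpleGraph.fromRel (fun u v =>
    (∃ i j : Fin r, u = Sum.inl i ∧ v = Sum.inl j ∧ (i : ℕ) + 1 = (j : ℕ)) ∨
    (∃ (i : Fin r) (k : Fin (p i)), u = Sum.inl i ∧ v = Sum.inr ⟨i, k⟩))

/-- Vertices with the same neighbours have the same columns in the Randić matrix. -/
lemma randicMatrix_apply_eq_of_neighborSet_eq {V : Type*} (G : SimpleGraph V) {v w : V}
    (h : G.neighborSet v = G.neighborSet w) (u : V) :
    randicMatrix G u v = randicMatrix G u w := by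
  have hadj : G.Adj u v ↔ G.Adj u w := by
    rw [G.adj_comm u v, G.adj_comm u w, ← SimpleGraph.mem_neighborSet, h,
      SimpleGraph.mem_neighborSet]
  by_cases huw : G.Adj u w
  · simp [randicMatrix, hadj.mpr huw, huw, h]
  · simp [randicMatrix, mt hadj.mp huw, huw]

lemma caterpillar_neighborSet_inr (r : ℕ) (p : Fin r → ℕ) (i : Fin r) (k : Fin (p i)) :
    (caterpillar r p).neighborSet (Sum.inr ⟨i, k⟩) = {Sum.inl i} := by
  ext u
  rcases u with j | ⟨j, l⟩
  · simp only [caterpillar, SimpleGraph.mem_neighborSet, SimpleGraph.fromRel_adj,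
      Set.mem_singleton_iff, Sum.inl.injEq, Sum.inr.injEq]
    constructor
    · rintro ⟨-, (⟨_, _, h, -⟩ | ⟨_, _, h, -⟩) | ⟨_, _, -, h, -⟩ | ⟨a, b, h, h'⟩⟩
      · simp at h
      · simp at h
      · simp at h
      · rw [h]
        exact (congrArg Sigma.fst h').symm
    · rintro rfl
      exact ⟨by simp, Or.inr (Or.inr ⟨_, k, rfl, rfl⟩)⟩
  · simp [caterpillar]

/-- The characteristic polynomial of a Hermitian matrix of corank `c` is divisible by `X ^ c`. -/
lemma Matrix.IsHermitian.X_pow_card_sub_rank_dvd_charpoly {n 𝕜 : Type*} [Fintype n]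
    [DecidableEq n] [RCLike 𝕜] {A : Matrix n n 𝕜} (hA : A.IsHermitian) :
    (X : Polynomial 𝕜) ^ (Fintype.card n - A.rank) ∣ A.charpoly := by
  classical
  have hcard : Fintype.card n - A.rank
      = (Finset.univ.filter fun i => hA.eigenvalues i = 0).card := by
    rw [hA.rank_eq_card_non_zero_eigs, Fintype.card_subtype_compl, Fintype.card_subtype]
    exact Nat.sub_sub_self (Finset.card_le_univ _)
  have hprod : (X : Polynomial 𝕜) ^ (Fintype.card n - A.rank)
      = ∏ i with hA.eigenvalues i = 0, (X - C (hA.eigenvalues i : 𝕜)) := by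
    rw [hcard, ← Finset.prod_const]
    refine Finset.prod_congr rfl fun i hi => ?_
    simp [(Finset.mem_filter.mp hi).2]
  rw [hA.charpoly_eq, hprod]
  exact Finset.prod_dvd_prod_of_subset _ _ _ (Finset.filter_subset _ _)

lemma randicMatrix_caterpillar_rank_le (r : ℕ) (p : Fin r → ℕ) (hp : ∀ i, 1 ≤ p i) :
    (randicMatrix (caterpillar r p)).rank ≤ r + r := by
  let rep : Fin r ⊕ Fin r → Fin r ⊕ (Σ i : Fin r, Fin (p i)) :=
    Sum.map id fun i => ⟨i, ⟨0, hp i⟩⟩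
  let spine : Fin r ⊕ (Σ i : Fin r, Fin (p i)) → Fin r ⊕ Fin r := Sum.map id Sigma.fst
  have hM : randicMatrix (caterpillar r p)
      = ((randicMatrix (caterpillar r p)).submatrix id rep).submatrix id spine := by
    ext u v
    rcases v with j | ⟨j, l⟩
    · rfl
    · exact randicMatrix_apply_eq_of_neighborSet_eq _
        ((caterpillar_neighborSet_inr r p j l).trans
          (caterpillar_neighborSet_inr r p j ⟨0, hp j⟩).symm) u
  rw [hM]
  calc _ ≤ _ := Matrix.rank_submatrix_le _ _ _
    _ ≤ _ := Matrix.rank_le_card_width _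
    _ = r + r := by simp

/-- For integers `r ≥ 2` and `p_1, …, p_r ≥ 1`, the power
`X^(Σᵢ (pᵢ - 1))` divides the characteristic polynomial of the Randić matrix of the caterpillar
`T(p_1, …, p_r)`; i.e. `0` is an eigenvalue of the Randić matrix with algebraic multiplicity at
least `Σᵢ (pᵢ - 1)`. -/
theorem caterpillar_randic_charpoly_zero_multiplicity (r : ℕ) (hr : 2 ≤ r) (p : Fin r → ℕ)
    (hp : ∀ i, 1 ≤ p i) :
    (X : Polynomial ℝ) ^ (∑ i, (p i - 1)) ∣ (randicMatrix (caterpillar r p)).charpoly := by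
  refine (pow_dvd_pow X ?_).trans
    (randicMatrix_isHermitian (caterpillar r p)).X_pow_card_sub_rank_dvd_charpoly
  have hrank := randicMatrix_caterpillar_rank_le r p hp
  have hsum : ∑ i, p i = ∑ i, (p i - 1) + r := by
    rw [← Finset.sum_congr rfl fun i _ => Nat.sub_add_cancel (hp i), Finset.sum_add_distrib]
    simp
  simp only [Fintype.card_sum, Fintype.card_fin, Fintype.card_sigma]
  omega
end
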